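/- Let m ≥ 2 be even and let S = {(α,β) ∈ 𝔽_{q^m} × 𝔽_{q^m} : α ≠ 0, β ≠ 0, Tr(α²) ≠ 0 and Tr(β²) ≠ 0}. Then #S = (q−1)²(q^{m−1} − ε·q^{(m−2)/2})², and every (α,β) ∈ S satisfies W(α,β) = 2(q−1)q^{2m−3} + 4ε(q−1)²q^{(3m−6)/2} + 2(q−1)(q−2)q^{m−2} (an equality of integers, with ε = ±1 as defined). -/

import Mathlib

open Finset

/-- The defining set `D = {(a,b) ≠ (0,0) : Tr(a²) = 0 and Tr(b²) = 0}`. -/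
noncomputable def defSet (q : ℕ) (F : Type*) [Field F] [Fintype F] [DecidableEq F]
    [Algebra (ZMod q) F] : Finset (F × F) :=
  Finset.univ.filter (fun p : F × F => p ≠ (0, 0) ∧
    Algebra.trace (ZMod q) F (p.1 ^ 2) = 0 ∧ Algebra.trace (ZMod q) F (p.2 ^ 2) = 0)

/-- The Lee weight `W(α,β)` of the codeword of `C_D` corresponding to `x = α + uβ`,
i.e. the Hamming weight of its Gray image. -/
noncomputable def leeW (q : ℕ) (F : Type*) [Field F] [Fintype F] [DecidableEq F]
    [Algebra (ZMod q) F] (α β : F) : ℕ :=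
  ((defSet q F).filter
      (fun p => Algebra.trace (ZMod q) F (α * p.1 + β * p.2) ≠ 0)).card +
  ((defSet q F).filter
      (fun p => Algebra.trace (ZMod q) F (β * p.1 + α * p.2) ≠ 0)).card

/-- For even `m`, the sign `ε = −(−1)^{((q−1)²m)/8}`, so that the quadratic Gauss sum
over `𝔽_{q^m}` equals `ε·q^{m/2}`. -/
def epsEven (q m : ℕ) : ℤ := -(-1 : ℤ) ^ ((q - 1) ^ 2 * m / 8)


section QuadraticGaussSum

set_option linter.unusedSectionVars false

variable (q : ℕ) [Fact q.Prime] (F : Type*) [Field F] [Fintype F] [Algebra (ZMod q) F]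

/-- The canonical additive character `x ↦ exp(2πi Tr(x)/q)` of `F`. -/
noncomputable def traceChar : AddChar F ℂ :=
  (ZMod.stdAddChar (N := q)).compAddMonoidHom (Algebra.trace (ZMod q) F).toAddMonoidHom

variable {q F}

lemma traceChar_apply (x : F) :
    traceChar q F x = ZMod.stdAddChar (Algebra.trace (ZMod q) F x) := rfl

lemma stdAddChar_eq_one_iff (t : ZMod q) : ZMod.stdAddChar t = (1 : ℂ) ↔ t = 0 := by
  rw [← AddChar.map_zero_eq_one (ZMod.stdAddChar (N := q)), ZMod.injective_stdAddChar.eq_iff]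

lemma traceChar_eq_one_iff (x : F) : traceChar q F x = 1 ↔ Algebra.trace (ZMod q) F x = 0 := by
  rw [traceChar_apply, stdAddChar_eq_one_iff]

lemma exists_trace_mul_ne_zero {a : F} (ha : a ≠ 0) :
    ∃ b : F, Algebra.trace (ZMod q) F (a * b) ≠ 0 := by
  by_contra! hf
  exact ha ((traceForm_nondegenerate (ZMod q) F).1 a hf)

lemma sum_traceChar_mul [DecidableEq F] (c : F) :
    ∑ x : F, traceChar q F (c * x) = if c = 0 then (Fintype.card F : ℂ) else 0 := by
  have hprim : (traceChar q F).IsPrimitive := by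
    intro a ha h
    obtain ⟨b, hb⟩ := exists_trace_mul_ne_zero (q := q) ha
    refine hb ((traceChar_eq_one_iff _).1 ?_)
    rw [← AddChar.mulShift_apply, h, AddChar.one_apply]
  simpa [mul_comm] using AddChar.sum_mulShift c hprim

lemma sum_stdAddChar_mul (c : ZMod q) :
    ∑ t : ZMod q, (ZMod.stdAddChar (t * c) : ℂ) = if c = 0 then (q : ℂ) else 0 := by
  simpa using AddChar.sum_mulShift c (ZMod.isPrimitive_stdAddChar q)

lemma charP_of_algebra_zmod (q : ℕ) [Fact q.Prime] (F : Type*) [Field F] [Algebra (ZMod q) F] :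
    CharP F q :=
  charP_of_injective_algebraMap (algebraMap (ZMod q) F).injective q

lemma add_pow_prime_pow (k : ℕ) (x y : F) : (x + y) ^ q ^ k = x ^ q ^ k + y ^ q ^ k := by
  have := charP_of_algebra_zmod q F
  exact add_pow_char_pow ..

lemma trace_pow_prime_pow (k : ℕ) (x : F) :
    Algebra.trace (ZMod q) F (x ^ q ^ k) = Algebra.trace (ZMod q) F x := by
  induction k with
  | zero => simp
  | succ k ih =>
    rw [pow_succ, pow_mul, ← ih]
    have := Algebra.trace_eq_of_algEquiv
      (FiniteField.frobeniusAlgEquivOfAlgebraic (ZMod q) F) (x ^ q ^ k)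
    simpa [FiniteField.coe_frobeniusAlgEquivOfAlgebraic, ZMod.card] using this

section HalfDegree

variable [DecidableEq F] {k : ℕ}

variable (q F k) in
/-- The elements of `F` fixed by `x ↦ x ^ q ^ k`. -/
def frobFixed : Finset F := univ.filter fun x => x ^ q ^ k = x

variable (q F k) in
/-- The elements of `F` negated by `x ↦ x ^ q ^ k`. -/
def frobNeg : Finset F := univ.filter fun x => x ^ q ^ k = -x

lemma pow_pow_of_card (hF : Fintype.card F = q ^ (2 * k)) (x : F) : (x ^ q ^ k) ^ q ^ k = x := by
  rw [← pow_mul, ← pow_add, ← two_mul, ← hF, FiniteField.pow_card]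

lemma two_ne_zero_of_odd (hq : Odd q) : (2 : F) ≠ 0 := by
  have := charP_of_algebra_zmod q F
  refine Ring.two_ne_zero ?_
  rw [ringChar.eq F q]
  rintro rfl
  exact absurd hq (by decide)

lemma neg_pow_prime_pow (hq : Odd q) (x : F) : (-x) ^ q ^ k = -x ^ q ^ k :=
  (hq.pow).neg_pow x

lemma exists_frobNeg_ne_zero (hq : Odd q) (hk : k ≠ 0) (hF : Fintype.card F = q ^ (2 * k)) :
    ∃ c ∈ frobNeg q F k, c ≠ 0 := by
  have hq1 := (Fact.out : q.Prime).one_lt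
  obtain ⟨x, hx⟩ : ∃ x : F, x ^ q ^ k ≠ x := by
    by_contra! h
    have h1 := FiniteField.X_pow_card_pow_sub_X_ne_zero F hk hq1
    have h2 : (univ : Finset F).val ≤ (Polynomial.X ^ q ^ k - Polynomial.X : Polynomial F).roots := by
      rw [Multiset.le_iff_subset univ.nodup]
      intro x _
      simp [Polynomial.mem_roots h1, h]
    have h3 := (Multiset.card_le_card h2).trans (Polynomial.card_roots' _)
    rw [FiniteField.X_pow_card_pow_sub_X_natDegree_eq F hk hq1] at h3
    have h4 : Fintype.card F ≤ q ^ k := h3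
    rw [hF] at h4
    have := (Nat.pow_le_pow_iff_right hq1).1 h4
    omega
  refine ⟨x + -x ^ q ^ k, ?_, ?_⟩
  · simp only [frobNeg, mem_filter, mem_univ, true_and]
    rw [add_pow_prime_pow, neg_pow_prime_pow hq, pow_pow_of_card hF]
    ring
  · intro h
    exact hx (by linear_combination -h)

lemma card_frobFixed_frobNeg (hq : Odd q) (hk : k ≠ 0) (hF : Fintype.card F = q ^ (2 * k)) :
    (frobFixed q F k).card = q ^ k ∧ (frobNeg q F k).card = q ^ k := by
  have h2 := two_ne_zero_of_odd (F := F) hq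
  obtain ⟨c, hc, hc0⟩ := exists_frobNeg_ne_zero (F := F) hq hk hF
  simp only [frobNeg, mem_filter, mem_univ, true_and] at hc
  have h1 : (frobFixed q F k).card = (frobNeg q F k).card := by
    refine card_nbij' (fun x => c * x) (fun x => c⁻¹ * x) ?_ ?_ ?_ ?_
    · intro x hx
      simp_all [frobFixed, frobNeg, mul_pow]
    · intro x hx
      simp_all [frobFixed, frobNeg, mul_pow, inv_neg]
    · intro x _
      simp [hc0]
    · intro x _
      simp [hc0]
  have h3 : ((frobFixed q F k) ×ˢ (frobNeg q F k)).card = (univ : Finset F).card := by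
    refine card_nbij' (fun x => x.1 + x.2)
      (fun x => (2⁻¹ * (x + x ^ q ^ k), 2⁻¹ * (x + -x ^ q ^ k))) ?_ ?_ ?_ ?_
    · intro x _
      simp
    · intro x _
      have h2' : (2⁻¹ : F) ^ q ^ k = 2⁻¹ := by
        have h := congrArg (algebraMap (ZMod q) F) (ZMod.pow_card_pow (n := k) 2)
        rw [map_pow, map_ofNat] at h
        rw [inv_pow, h]
      simp only [frobFixed, frobNeg, coe_product, Set.mem_prod, mem_coe, mem_filter, mem_univ,
        true_and, mul_pow, h2', add_pow_prime_pow, neg_pow_prime_pow hq, pow_pow_of_card hF]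
      constructor <;> ring
    · rintro ⟨x, y⟩ hxy
      simp only [frobFixed, frobNeg, coe_product, Set.mem_prod, mem_coe, mem_filter, mem_univ,
        true_and] at hxy
      simp only [add_pow_prime_pow, hxy]
      ext <;> field_simp <;> ring
    · intro x _
      field_simp
      ring
  rw [card_product, h1, card_univ, hF, two_mul, pow_add] at h3
  have := Nat.mul_self_inj.1 h3
  exact ⟨h1.trans this, this⟩

lemma sum_frobFixed_traceChar (hq : Odd q) (hk : k ≠ 0) (hF : Fintype.card F = q ^ (2 * k))
    (c : F) :
    ∑ y ∈ frobFixed q F k, traceChar q F (y * c) =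
      if c ∈ frobNeg q F k then (q ^ k : ℂ) else 0 := by
  split_ifs with hc
  · simp only [frobNeg, mem_filter, mem_univ, true_and] at hc
    have h1 : ∀ y ∈ frobFixed q F k, traceChar q F (y * c) = 1 := by
      intro y hy
      simp only [frobFixed, mem_filter, mem_univ, true_and] at hy
      rw [traceChar_eq_one_iff]
      have h := trace_pow_prime_pow (q := q) k (y * c)
      rw [mul_pow, hy, hc, mul_neg, map_neg] at h
      have h2 := two_ne_zero_of_odd (q := q) (F := ZMod q) hq
      refine (mul_eq_zero.1 ?_).resolve_left h2
      linear_combination -h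
    rw [sum_congr rfl h1, sum_const, (card_frobFixed_frobNeg hq hk hF).1]
    simp
  · have hu : c + c ^ q ^ k ≠ 0 := by
      intro h
      refine hc ?_
      simp only [frobNeg, mem_filter, mem_univ, true_and]
      linear_combination h
    obtain ⟨b, hb⟩ := exists_trace_mul_ne_zero (q := q) hu
    have hy0 : (b + b ^ q ^ k) ^ q ^ k = b + b ^ q ^ k := by
      rw [add_pow_prime_pow, pow_pow_of_card hF, add_comm]
    have hne : traceChar q F ((b + b ^ q ^ k) * c) ≠ 1 := by
      rw [Ne, traceChar_eq_one_iff]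
      have h := trace_pow_prime_pow (q := q) k (b ^ q ^ k * c)
      rw [mul_pow, pow_pow_of_card hF] at h
      rw [add_mul, map_add, ← h, ← map_add]
      rwa [show b * c + b * c ^ q ^ k = (c + c ^ q ^ k) * b by ring]
    refine eq_zero_of_mul_eq_self_left hne ?_
    rw [mul_sum]
    refine sum_nbij' (fun y => b + b ^ q ^ k + y) (fun y => y + -(b + b ^ q ^ k)) ?_ ?_ ?_ ?_ ?_
    · intro y hy
      simp only [frobFixed, mem_filter, mem_univ, true_and] at hy ⊢
      rw [add_pow_prime_pow, hy0, hy]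
    · intro y hy
      simp only [frobFixed, mem_filter, mem_univ, true_and] at hy ⊢
      rw [add_pow_prime_pow, neg_pow_prime_pow hq, hy0, hy]
    · intro y _
      ring
    · intro y _
      ring
    · intro y _
      rw [← AddChar.map_add_eq_mul]
      ring_nf

lemma isSquare_iff_pow (hq : Odd q) (hF : Fintype.card F = q ^ (2 * k)) {a : F} (ha : a ≠ 0) :
    IsSquare a ↔ (a ^ (q ^ k - 1)) ^ ((q ^ k + 1) / 2) = 1 := by
  have h2 : ringChar F ≠ 2 := fun h => two_ne_zero_of_odd (F := F) hq <| by
    have := ringChar.Nat.cast_ringChar (R := F)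
    rw [h] at this
    exact_mod_cast this
  obtain ⟨j, hj⟩ := hq.pow (n := k)
  rw [FiniteField.isSquare_iff h2 ha, ← pow_mul, hF, two_mul k, pow_add, hj]
  congr! 2
  have h1 : (2 * j + 1) * (2 * j + 1) = 2 * (2 * j * (j + 1)) + 1 := by ring
  have h3 : (2 * j + 1 + 1) / 2 = j + 1 := by omega
  rw [h1, h3, Nat.add_sub_cancel]
  omega

lemma isSquare_of_mem_frobFixed (hq : Odd q) (hF : Fintype.card F = q ^ (2 * k)) {a : F}
    (ha : a ∈ frobFixed q F k) : IsSquare a := by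
  rcases eq_or_ne a 0 with rfl | h0
  · exact IsSquare.zero
  simp only [frobFixed, mem_filter, mem_univ, true_and] at ha
  rw [isSquare_iff_pow hq hF h0]
  rw [pow_sub₀ a h0 (Nat.one_le_pow _ _ (Fact.out : q.Prime).pos), ha, pow_one, mul_inv_cancel₀ h0,
    one_pow]

lemma card_sq_mem_frobNeg (hq : Odd q) (hk : k ≠ 0) (hF : Fintype.card F = q ^ (2 * k)) :
    ((univ.filter fun x : F => x ^ 2 ∈ frobNeg q F k).card : ℤ) =
      1 + (q ^ k - 1) * (1 + (-1) ^ ((q ^ k + 1) / 2)) := by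
  have h2 := two_ne_zero_of_odd (F := F) hq
  obtain ⟨hE, hE'⟩ := card_frobFixed_frobNeg (F := F) hq hk hF
  obtain ⟨c, hc, hc0⟩ := exists_frobNeg_ne_zero (F := F) hq hk hF
  have hpow : ∀ a ∈ frobNeg q F k, a ≠ 0 → a ^ (q ^ k - 1) = -1 := by
    intro a ha ha0
    simp only [frobNeg, mem_filter, mem_univ, true_and] at ha
    rw [pow_sub₀ a ha0 (Nat.one_le_pow _ _ (Fact.out : q.Prime).pos), ha, pow_one, neg_mul,
      mul_inv_cancel₀ ha0]
  have h1 : (1 : F) ≠ -1 := fun h => h2 (by linear_combination h)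
  rcases Nat.even_or_odd ((q ^ k + 1) / 2) with he | ho
  · obtain ⟨w, hw⟩ : IsSquare c := by
      rw [isSquare_iff_pow hq hF hc0, hpow c hc hc0, he.neg_one_pow]
    have hw0 : w ≠ 0 := by
      rintro rfl
      simp_all
    have hsq : (univ.filter fun x : F => x ^ 2 ∈ frobNeg q F k).card =
        (frobFixed q F k ∪ frobNeg q F k).card := by
      simp only [frobNeg, mem_filter, mem_univ, true_and] at hc
      have key : ∀ z : F, (w * z) ^ 2 ∈ frobNeg q F k ↔ z ∈ frobFixed q F k ∪ frobNeg q F k := by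
        intro z
        simp only [frobFixed, frobNeg, mem_union, mem_filter, mem_univ, true_and]
        rw [← sq_eq_sq_iff_eq_or_eq_neg, mul_pow, mul_pow, sq w, ← hw, hc, ← neg_mul,
          mul_right_inj' (neg_ne_zero.2 hc0), pow_right_comm]
      refine (card_nbij' (fun z => w * z) (fun z => w⁻¹ * z) ?_ ?_ ?_ ?_).symm
      · intro z hz
        simpa using (key z).2 hz
      · intro z hz
        refine (key _).1 ?_
        simpa [hw0] using hz
      · intro z _
        simp [hw0]
      · intro z _
        simp [hw0]
    have hinter : frobFixed q F k ∩ frobNeg q F k = {0} := by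
      ext x
      simp only [frobFixed, frobNeg, mem_inter, mem_filter, mem_univ, true_and, mem_singleton]
      constructor
      · rintro ⟨hx, hx'⟩
        refine (mul_eq_zero.1 ?_).resolve_left h2
        linear_combination hx' - hx
      · rintro rfl
        simp [(Fact.out : q.Prime).ne_zero]
    have := card_union_add_card_inter (frobFixed q F k) (frobNeg q F k)
    rw [hinter, card_singleton, hE, hE'] at this
    rw [hsq, he.neg_one_pow]
    zify at this
    linear_combination this
  · have hsing : (univ.filter fun x : F => x ^ 2 ∈ frobNeg q F k) = {0} := by
      ext x
      simp only [mem_filter, mem_univ, true_and, mem_singleton]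
      constructor
      · intro hx
        by_contra hx0
        have hx2 := pow_ne_zero 2 hx0
        have := (isSquare_iff_pow hq hF hx2).1 (IsSquare.sq x)
        rw [hpow _ hx hx2, ho.neg_one_pow] at this
        exact h1 this.symm
      · rintro rfl
        simp [frobNeg, (Fact.out : q.Prime).ne_zero]
    rw [hsing, ho.neg_one_pow]
    simp

/-- The quadratic Gauss sum of a finite field of even degree over its prime field. -/
theorem sum_traceChar_sq (hq : Odd q) (hk : k ≠ 0) (hF : Fintype.card F = q ^ (2 * k)) :
    ∑ x : F, traceChar q F (x ^ 2) = (-1) ^ ((q ^ k + 1) / 2) * (q : ℂ) ^ k := by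
  have hsq : ∀ y ∈ (frobFixed q F k).erase 0,
      ∑ x : F, traceChar q F (y * x ^ 2) = ∑ x : F, traceChar q F (x ^ 2) := by
    intro y hy
    obtain ⟨hy0, hy⟩ := mem_erase.1 hy
    obtain ⟨w, rfl⟩ := isSquare_of_mem_frobFixed hq hF hy
    have hw : w ≠ 0 := by
      rintro rfl
      simp at hy0
    exact Fintype.sum_equiv (Equiv.mulLeft₀ w hw) _ _ fun x => by
      rw [Equiv.mulLeft₀_apply, mul_pow, sq w]
  have h0 : (0 : F) ∈ frobFixed q F k := by simp [frobFixed, (Fact.out : q.Prime).ne_zero]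
  have hleft : ∑ y ∈ frobFixed q F k, ∑ x : F, traceChar q F (y * x ^ 2) =
      (q : ℂ) ^ (2 * k) + ((q : ℂ) ^ k - 1) * ∑ x : F, traceChar q F (x ^ 2) := by
    rw [← add_sum_erase _ _ h0, sum_congr rfl hsq, sum_const, card_erase_of_mem h0,
      (card_frobFixed_frobNeg hq hk hF).1, nsmul_eq_mul,
      Nat.cast_sub (Nat.one_le_pow _ _ (Fact.out : q.Prime).pos)]
    simp [hF]
  have hM := congrArg (Int.cast : ℤ → ℂ) (card_sq_mem_frobNeg (F := F) hq hk hF)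
  push_cast at hM
  rw [sum_comm, sum_congr rfl fun x _ => sum_frobFixed_traceChar hq hk hF (x ^ 2), ← sum_filter,
    sum_const, nsmul_eq_mul, hM] at hleft
  have hq1 : (q : ℂ) ^ k - 1 ≠ 0 := by
    have : 1 < q ^ k := Nat.one_lt_pow hk (Fact.out : q.Prime).one_lt
    rw [sub_ne_zero]
    exact_mod_cast this.ne'
  refine mul_left_cancel₀ hq1 ?_
  linear_combination -hleft

lemma epsEven_two_mul (hq : Odd q) (k : ℕ) : epsEven q (2 * k) = (-1) ^ ((q ^ k + 1) / 2) := by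
  obtain ⟨j, rfl⟩ := hq
  have h1 : (2 * j + 1 - 1) ^ 2 * (2 * k) / 8 = j ^ 2 * k := by
    rw [Nat.add_sub_cancel, show (2 * j) ^ 2 * (2 * k) = 8 * (j ^ 2 * k) by ring]
    omega
  have h2 : ∃ l, (2 * j + 1) ^ k = 4 * l + 2 * (j * k) + 1 := by
    clear h1
    induction k with
    | zero => exact ⟨0, by simp⟩
    | succ k ih =>
      obtain ⟨l, hl⟩ := ih
      exact ⟨2 * j * l + l + j ^ 2 * k, by rw [pow_succ, hl]; ring⟩
  obtain ⟨l, hl⟩ := h2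
  have h3 : ((2 * j + 1) ^ k + 1) / 2 = 2 * l + j * k + 1 := by omega
  have h4 : (-1 : ℤ) ^ (j ^ 2 * k) = (-1) ^ (j * k) := by
    rw [sq, mul_assoc, pow_mul]
    rcases Nat.even_or_odd j with h | h
    · rw [h.neg_one_pow, one_pow, (h.mul_right k).neg_one_pow]
    · rw [h.neg_one_pow]
  rw [epsEven, h1, h3, h4, pow_succ, pow_add, pow_mul _ 2 l]
  simp

lemma isSquare_algebraMap (hq : Odd q) (hF : Fintype.card F = q ^ (2 * k)) (t : ZMod q) :
    IsSquare (algebraMap (ZMod q) F t) := by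
  refine isSquare_of_mem_frobFixed (k := k) hq hF ?_
  simp only [frobFixed, mem_filter, mem_univ, true_and]
  rw [← map_pow, ZMod.pow_card_pow]

lemma sum_traceChar_quadratic (hq : Odd q) (hF : Fintype.card F = q ^ (2 * k)) {t : ZMod q}
    (ht : t ≠ 0) (γ : F) :
    ∑ x : F, traceChar q F (algebraMap (ZMod q) F t * x ^ 2 + γ * x) =
      ZMod.stdAddChar (-(4 * t)⁻¹ * Algebra.trace (ZMod q) F (γ ^ 2)) *
        ∑ x : F, traceChar q F (x ^ 2) := by
  have h2 := two_ne_zero_of_odd (q := q) (F := F) hq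
  have h4 : (4 : F) ≠ 0 := by
    rw [show (4 : F) = 2 * 2 by norm_num]
    exact mul_ne_zero h2 h2
  obtain ⟨w, hw⟩ := isSquare_algebraMap (F := F) hq hF t
  have hw0 : w ≠ 0 := by
    rintro rfl
    simp [ht] at hw
  rw [mul_sum]
  refine Fintype.sum_equiv ((Equiv.mulLeft₀ w hw0).trans (Equiv.addRight (γ / (2 * w)))) _ _
    fun x => ?_
  have htr : -(4 * t)⁻¹ * Algebra.trace (ZMod q) F (γ ^ 2) =
      Algebra.trace (ZMod q) F (-(4 * (w * w))⁻¹ * γ ^ 2) := by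
    have h4t : algebraMap (ZMod q) F (4 * t) = 4 * (w * w) := by rw [map_mul, map_ofNat, hw]
    rw [← smul_eq_mul, ← map_smul, Algebra.smul_def, map_neg (algebraMap (ZMod q) F), map_inv₀,
      h4t]
  rw [htr, ← traceChar_apply, ← AddChar.map_add_eq_mul, hw]
  congr 1
  simp only [Equiv.trans_apply, Equiv.mulLeft₀_apply, Equiv.coe_addRight]
  field_simp
  ring

variable (q F) in
/-- The elements of `F` whose square has trace zero. -/
noncomputable def traceSqZero : Finset F :=
  univ.filter fun x => Algebra.trace (ZMod q) F (x ^ 2) = 0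

lemma mul_sum_traceSqZero (hq : Odd q) (hF : Fintype.card F = q ^ (2 * k)) (γ : F) :
    (q : ℂ) * ∑ x ∈ traceSqZero q F, traceChar q F (γ * x) =
      (if γ = 0 then (q : ℂ) ^ (2 * k) else 0) +
        ((if Algebra.trace (ZMod q) F (γ ^ 2) = 0 then (q : ℂ) else 0) - 1) *
          ∑ x : F, traceChar q F (x ^ 2) := by
  have h4 : (4 : ZMod q) ≠ 0 := by
    have h2 := two_ne_zero_of_odd (q := q) (F := ZMod q) hq
    rw [show (4 : ZMod q) = 2 * 2 by norm_num]
    exact mul_ne_zero h2 h2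
  have hswap : (q : ℂ) * ∑ x ∈ traceSqZero q F, traceChar q F (γ * x) =
      ∑ t : ZMod q, ∑ x : F, traceChar q F (algebraMap (ZMod q) F t * x ^ 2 + γ * x) := by
    rw [sum_comm, mul_sum, traceSqZero, sum_filter]
    refine sum_congr rfl fun x _ => ?_
    have h : ∀ t : ZMod q, traceChar q F (algebraMap (ZMod q) F t * x ^ 2 + γ * x) =
        ZMod.stdAddChar (t * Algebra.trace (ZMod q) F (x ^ 2)) * traceChar q F (γ * x) := by
      intro t
      rw [AddChar.map_add_eq_mul, traceChar_apply (_ * x ^ 2), ← Algebra.smul_def, map_smul,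
        smul_eq_mul]
    simp_rw [h]
    rw [← sum_mul, sum_stdAddChar_mul]
    split_ifs <;> simp
  have hinv : Function.Involutive fun t : ZMod q => -(4 * t)⁻¹ := by
    intro t
    rcases eq_or_ne t 0 with rfl | ht
    · simp
    · field_simp
  have hsum : ∑ t : ZMod q,
      (ZMod.stdAddChar (-(4 * t)⁻¹ * Algebra.trace (ZMod q) F (γ ^ 2)) : ℂ) =
        if Algebra.trace (ZMod q) F (γ ^ 2) = 0 then (q : ℂ) else 0 := by
    rw [← sum_stdAddChar_mul]
    exact Fintype.sum_equiv hinv.toPerm _ _ fun t => rfl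
  rw [hswap, ← add_sum_erase _ _ (mem_univ 0), sum_congr rfl fun t ht =>
    sum_traceChar_quadratic hq hF (mem_erase.1 ht).1 γ, ← sum_mul, ← hsum,
    ← add_sum_erase _ (fun t : ZMod q => (ZMod.stdAddChar (-(4 * t)⁻¹ *
      Algebra.trace (ZMod q) F (γ ^ 2)) : ℂ)) (mem_univ 0)]
  simp [sum_traceChar_mul, hF]

lemma mul_card_traceSqZero (hq : Odd q) (hk : k ≠ 0) (hF : Fintype.card F = q ^ (2 * k)) :
    (q : ℤ) * (traceSqZero q F).card =
      (q : ℤ) ^ (2 * k) + (q - 1) * (epsEven q (2 * k) * (q : ℤ) ^ k) := by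
  have h := mul_sum_traceSqZero (F := F) hq hF 0
  rw [sum_traceChar_sq hq hk hF] at h
  simp only [zero_mul, AddChar.map_zero_eq_one, sum_const, nsmul_eq_mul, mul_one, if_true,
    ne_eq, OfNat.ofNat_ne_zero, not_false_eq_true, zero_pow, map_zero] at h
  rw [epsEven_two_mul hq]
  exact_mod_cast h

lemma card_trace_linear_eq_zero (hq : Odd q) (hk : k ≠ 0) (hF : Fintype.card F = q ^ (2 * k))
    {α β : F} (hα : Algebra.trace (ZMod q) F (α ^ 2) ≠ 0)
    (hβ : Algebra.trace (ZMod q) F (β ^ 2) ≠ 0) :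
    (q : ℤ) ^ 3 * ((traceSqZero q F ×ˢ traceSqZero q F).filter fun p =>
        Algebra.trace (ZMod q) F (α * p.1 + β * p.2) = 0).card =
      ((q : ℤ) * (traceSqZero q F).card) ^ 2 + (q - 1) * (q : ℤ) ^ (2 * k) := by
  have hG : (∑ x : F, traceChar q F (x ^ 2)) ^ 2 = (q : ℂ) ^ (2 * k) := by
    rw [sum_traceChar_sq hq hk hF, mul_pow, pow_right_comm, neg_one_sq, one_pow, one_mul, ← pow_mul,
      mul_comm k]
  have hcount : (q : ℂ) * ((traceSqZero q F ×ˢ traceSqZero q F).filter fun p =>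
        Algebra.trace (ZMod q) F (α * p.1 + β * p.2) = 0).card =
      ∑ z : ZMod q, (∑ x ∈ traceSqZero q F, traceChar q F (algebraMap (ZMod q) F z * α * x)) *
        ∑ y ∈ traceSqZero q F, traceChar q F (algebraMap (ZMod q) F z * β * y) := by
    have h : ∀ z : ZMod q, ∀ p : F × F, traceChar q F (algebraMap (ZMod q) F z * α * p.1) *
        traceChar q F (algebraMap (ZMod q) F z * β * p.2) =
        ZMod.stdAddChar (z * Algebra.trace (ZMod q) F (α * p.1 + β * p.2)) := by
      intro z p
      rw [← AddChar.map_add_eq_mul, mul_assoc, mul_assoc, ← mul_add, traceChar_apply,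
        ← Algebra.smul_def, map_smul, smul_eq_mul]
    rw [sum_congr rfl fun z _ => (sum_mul_sum _ _ _ _).trans ((sum_product' _ _ _).symm.trans
      (sum_congr rfl fun p _ => h z p)), sum_comm, sum_congr rfl fun p _ => sum_stdAddChar_mul _,
      ← sum_filter, sum_const, nsmul_eq_mul, mul_comm]
  have hterm : ∀ {δ : F}, Algebra.trace (ZMod q) F (δ ^ 2) ≠ 0 → ∀ z : ZMod q, z ≠ 0 →
      (q : ℂ) * ∑ x ∈ traceSqZero q F, traceChar q F (algebraMap (ZMod q) F z * δ * x) =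
        -∑ x : F, traceChar q F (x ^ 2) := by
    intro δ hδ z hz
    have hδ0 : δ ≠ 0 := by
      rintro rfl
      simp at hδ
    have htr : Algebra.trace (ZMod q) F ((algebraMap (ZMod q) F z * δ) ^ 2) ≠ 0 := by
      rw [mul_pow, ← map_pow, ← Algebra.smul_def, map_smul, smul_eq_mul]
      exact mul_ne_zero (pow_ne_zero 2 hz) hδ
    rw [mul_sum_traceSqZero hq hF, if_neg htr, if_neg (mul_ne_zero (by simpa using hz) hδ0)]
    ring
  have hmain : (q : ℂ) ^ 2 * ((q : ℂ) * ((traceSqZero q F ×ˢ traceSqZero q F).filter fun p =>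
        Algebra.trace (ZMod q) F (α * p.1 + β * p.2) = 0).card) =
      ((q : ℂ) * (traceSqZero q F).card) ^ 2 + (q - 1) * (q : ℂ) ^ (2 * k) := by
    have hz : ∀ z ∈ univ.erase (0 : ZMod q), (q : ℂ) ^ 2 *
        ((∑ x ∈ traceSqZero q F, traceChar q F (algebraMap (ZMod q) F z * α * x)) *
          ∑ y ∈ traceSqZero q F, traceChar q F (algebraMap (ZMod q) F z * β * y)) =
        (q : ℂ) ^ (2 * k) := by
      intro z hz
      have hz0 := (mem_erase.1 hz).1
      rw [sq, mul_mul_mul_comm, hterm hα z hz0, hterm hβ z hz0, neg_mul_neg, ← sq, hG]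
    rw [hcount, mul_sum, ← add_sum_erase _ _ (mem_univ 0), sum_congr rfl hz, sum_const,
      card_erase_of_mem (mem_univ 0), card_univ, ZMod.card, nsmul_eq_mul,
      Nat.cast_sub (Fact.out : q.Prime).one_le]
    simp only [map_zero, zero_mul, AddChar.map_zero_eq_one, sum_const, nsmul_eq_mul, mul_one,
      Nat.cast_one]
    ring
  rw [← mul_assoc, ← pow_succ] at hmain
  exact_mod_cast hmain

lemma card_defSet_trace_linear_ne_zero (hq : Odd q) {l : ℕ}
    (hF : Fintype.card F = q ^ (2 * (l + 1))) {α β : F}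
    (hα : Algebra.trace (ZMod q) F (α ^ 2) ≠ 0) (hβ : Algebra.trace (ZMod q) F (β ^ 2) ≠ 0) :
    (((defSet q F).filter fun p =>
        Algebra.trace (ZMod q) F (α * p.1 + β * p.2) ≠ 0).card : ℤ) =
      ((q : ℤ) - 1) * ((q : ℤ) ^ (4 * l + 1) +
        2 * epsEven q (2 * (l + 1)) * (q - 1) * (q : ℤ) ^ (3 * l) +
        (q - 2) * (q : ℤ) ^ (2 * l)) := by
  have hset : (defSet q F).filter (fun p => Algebra.trace (ZMod q) F (α * p.1 + β * p.2) ≠ 0) =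
      (traceSqZero q F ×ˢ traceSqZero q F).filter fun p =>
        ¬ Algebra.trace (ZMod q) F (α * p.1 + β * p.2) = 0 := by
    ext ⟨a, b⟩
    simp only [defSet, traceSqZero, mem_filter, mem_univ, true_and, mem_product]
    constructor
    · rintro ⟨⟨-, h⟩, h'⟩
      exact ⟨h, h'⟩
    · rintro ⟨h, h'⟩
      refine ⟨⟨?_, h⟩, h'⟩
      rintro ⟨⟩
      simp at h'
  have hsplit := card_filter_add_card_filter_not (s := traceSqZero q F ×ˢ traceSqZero q F)
    fun p => Algebra.trace (ZMod q) F (α * p.1 + β * p.2) = 0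
  have hC := card_trace_linear_eq_zero hq l.succ_ne_zero hF hα hβ
  have hN := mul_card_traceSqZero hq l.succ_ne_zero hF
  have heps : epsEven q (2 * (l + 1)) ^ 2 = 1 := by
    rw [epsEven, neg_sq, ← pow_mul, mul_comm, pow_mul]
    norm_num
  rw [card_product] at hsplit
  rw [hset]
  zify at hsplit
  have hq0 : (q : ℤ) ≠ 0 := by exact_mod_cast (Fact.out : q.Prime).ne_zero
  refine mul_left_cancel₀ (pow_ne_zero 3 hq0) ?_
  rw [Nat.succ_eq_add_one] at hC hN
  generalize epsEven q (2 * (l + 1)) = e at *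
  rw [hN] at hC
  have hN2 := congrArg (fun x => x ^ 2) hN
  simp only [mul_pow] at hN2
  linear_combination (q : ℤ) ^ 3 * hsplit - hC + (q : ℤ) * hN2 +
    (q - 1) ^ 3 * (q : ℤ) ^ (2 * (l + 1)) * heps

end HalfDegree

end QuadraticGaussSum

theorem stmt17 (q m : ℕ) [Fact q.Prime] (hq : Odd q) (hm : 2 ≤ m) (hmeven : Even m)
    (F : Type*) [Field F] [Fintype F] [DecidableEq F] [Algebra (ZMod q) F]
    (hF : Fintype.card F = q ^ m)
    (S : Finset (F × F))
    (hS : S = Finset.univ.filter (fun p : F × F => p.1 ≠ 0 ∧ p.2 ≠ 0 ∧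
      Algebra.trace (ZMod q) F (p.1 ^ 2) ≠ 0 ∧ Algebra.trace (ZMod q) F (p.2 ^ 2) ≠ 0)) :
    (S.card : ℤ) = ((q : ℤ) - 1) ^ 2 *
        ((q : ℤ) ^ (m - 1) - epsEven q m * (q : ℤ) ^ ((m - 2) / 2)) ^ 2 ∧
    ∀ p ∈ S, (leeW q F p.1 p.2 : ℤ) =
      2 * ((q : ℤ) - 1) * (q : ℤ) ^ (2 * m - 3) +
        4 * epsEven q m * ((q : ℤ) - 1) ^ 2 * (q : ℤ) ^ ((3 * m - 6) / 2) +
        2 * ((q : ℤ) - 1) * ((q : ℤ) - 2) * (q : ℤ) ^ (m - 2) := by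
  obtain ⟨k, rfl⟩ := hmeven.exists_two_nsmul
  rw [smul_eq_mul] at *
  obtain ⟨l, rfl⟩ : ∃ l, k = l + 1 := ⟨k - 1, by omega⟩
  have hq0 : (q : ℤ) ≠ 0 := by exact_mod_cast (Fact.out : q.Prime).ne_zero
  rw [show 2 * (l + 1) - 1 = 2 * l + 1 by omega, show (2 * (l + 1) - 2) / 2 = l by omega,
    show 2 * (2 * (l + 1)) - 3 = 4 * l + 1 by omega,
    show (3 * (2 * (l + 1)) - 6) / 2 = 3 * l by omega, show 2 * (l + 1) - 2 = 2 * l by omega]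
  constructor
  · have hprod : S = (univ.filter fun x : F => ¬ Algebra.trace (ZMod q) F (x ^ 2) = 0) ×ˢ
        (univ.filter fun x : F => ¬ Algebra.trace (ZMod q) F (x ^ 2) = 0) := by
      ext ⟨a, b⟩
      simp only [hS, mem_filter, mem_univ, true_and, mem_product]
      constructor
      · rintro ⟨-, -, h⟩
        exact h
      · rintro ⟨ha, hb⟩
        refine ⟨?_, ?_, ha, hb⟩
        · rintro rfl
          simp at ha
        · rintro rfl
          simp at hb
    have hsplit := card_filter_add_card_filter_not (s := (univ : Finset F))
      fun x => Algebra.trace (ZMod q) F (x ^ 2) = 0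
    have hN := mul_card_traceSqZero (F := F) hq l.succ_ne_zero hF
    rw [traceSqZero, Nat.succ_eq_add_one] at hN
    rw [card_univ, hF] at hsplit
    rw [hprod, card_product, Nat.cast_mul, ← sq, ← mul_pow]
    congr 1
    zify at hsplit
    refine mul_left_cancel₀ hq0 ?_
    linear_combination (q : ℤ) * hsplit - hN
  · intro p hp
    rw [hS, mem_filter] at hp
    obtain ⟨-, -, -, hα, hβ⟩ := hp
    rw [leeW, Nat.cast_add, card_defSet_trace_linear_ne_zero hq hF hα hβ,
      card_defSet_trace_linear_ne_zero hq hF hβ hα]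
    ring
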